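/- Let I ≥ 1 and m ≥ 1 be integers and let u : {1,…,I} → ℤ satisfy |u(j)| ≤ m for all j and Σ_{j=1}^{I} u(j) ≥ I + m. Then there exists a partition 𝒫 of {1,…,I} into nonempty pairwise disjoint parts covering {1,…,I} such that every part P ∈ 𝒫 has cardinality |P| ≤ 2m + 1 and nonnegative total weight Σ_{j∈P} u(j) ≥ 0. -/

import Mathlib

theorem bc_step (m : ℕ) (hm : 1 ≤ m) (u : ℕ → ℤ) (S : Finset ℕ) (hS : S.Nonempty)
    (hbd : ∀ j ∈ S, |u j| ≤ (m : ℤ)) (hsum : 0 ≤ ∑ j ∈ S, u j) :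
    ∃ P ⊆ S, P.Nonempty ∧ P.card ≤ 2 * m + 1 ∧ 0 ≤ ∑ j ∈ P, u j ∧ 0 ≤ ∑ j ∈ S \ P, u j := by
  by_contra hno
  have hno' : ∀ P ⊆ S, P.Nonempty → P.card ≤ 2 * m + 1 → 0 ≤ ∑ j ∈ P, u j →
      0 ≤ ∑ j ∈ S \ P, u j → False := fun P h1 h2 h3 h4 h5 => hno ⟨P, h1, h2, h3, h4, h5⟩
  have key : ∀ A : Finset ℕ, ∃ B, A ⊆ B ∧ (A ⊆ S → A.card ≤ 2 * m → -(m : ℤ) < ∑ j ∈ A, u j →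
      ∑ j ∈ A, u j ≤ m → B ⊆ S ∧ B.card = A.card + 1 ∧ -(m : ℤ) < ∑ j ∈ B, u j ∧
        ∑ j ∈ B, u j ≤ m) := by
    intro A
    by_cases hg : A ⊆ S ∧ A.card ≤ 2 * m ∧ -(m : ℤ) < ∑ j ∈ A, u j ∧ ∑ j ∈ A, u j ≤ m
    swap
    · exact ⟨A, subset_rfl, fun a b c d => (hg ⟨a, b, c, d⟩).elim⟩
    obtain ⟨hA, hc, hl, hu⟩ := hg
    have hsplit := Finset.sum_sdiff (f := u) hA
    have hx : ∃ x ∈ S \ A, -(m : ℤ) < u x + ∑ j ∈ A, u j ∧ u x + ∑ j ∈ A, u j ≤ m := by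
      by_contra hcon
      have hcon' : ∀ x ∈ S \ A, -(m : ℤ) < u x + ∑ j ∈ A, u j → u x + ∑ j ∈ A, u j ≤ m → False :=
        fun x h1 h2 h3 => hcon ⟨x, h1, h2, h3⟩
      rcases le_or_gt (∑ j ∈ A, u j) 0 with hs | hs
      · have hnp : ∀ x ∈ S \ A, u x ≤ 0 := by
          intro x hx
          by_contra hpos
          have := abs_le.1 (hbd x (Finset.mem_sdiff.1 hx).1)
          exact hcon' x hx (by linarith) (by linarith)
        have hle := Finset.sum_nonpos hnp
        rcases A.eq_empty_or_nonempty with rfl | hne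
        · simp only [Finset.sdiff_empty] at hnp
          have hz := (Finset.sum_eq_zero_iff_of_nonpos hnp).1
            (le_antisymm (Finset.sum_nonpos hnp) hsum)
          obtain ⟨x, hx⟩ := hS
          refine hno' {x} (by simpa using hx) (by simp) (by simp) (by simp [hz x hx]) ?_
          exact (Finset.sum_eq_zero fun y hy => hz y (Finset.mem_sdiff.1 hy).1).ge
        · exact hno' A hA hne (by omega) (by linarith) (by linarith)
      · have hnn : ∀ x ∈ S \ A, 0 ≤ u x := by
          intro x hx
          by_contra hpos
          have := abs_le.1 (hbd x (Finset.mem_sdiff.1 hx).1)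
          exact hcon' x hx (by linarith) (by linarith)
        refine hno' A hA ?_ (by omega) hs.le (Finset.sum_nonneg hnn)
        by_contra hne
        rw [Finset.not_nonempty_iff_eq_empty] at hne
        simp [hne] at hs
    obtain ⟨x, hx, h1, h2⟩ := hx
    have hx' := Finset.mem_sdiff.1 hx
    refine ⟨insert x A, Finset.subset_insert _ _, fun _ _ _ _ => ⟨?_, ?_, ?_, ?_⟩⟩
    · exact Finset.insert_subset hx'.1 hA
    · exact Finset.card_insert_of_notMem hx'.2
    · rwa [Finset.sum_insert hx'.2]
    · rwa [Finset.sum_insert hx'.2]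
  choose F hF1 hF2 using key
  let A : ℕ → Finset ℕ := fun n => F^[n] ∅
  have hAs : ∀ n, A (n + 1) = F (A n) := fun n => Function.iterate_succ_apply' F n ∅
  have hmono : Monotone A := monotone_nat_of_le_succ fun n => by rw [hAs]; exact hF1 _
  have hinv : ∀ n ≤ 2 * m, A n ⊆ S ∧ (A n).card = n ∧ -(m : ℤ) < ∑ j ∈ A n, u j ∧
      ∑ j ∈ A n, u j ≤ m := by
    intro n
    induction n with
    | zero => intro _; simp [A]; omega
    | succ n ih =>
      intro hn
      obtain ⟨a, b, c, d⟩ := ih (by omega)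
      have := hF2 (A n) a (by omega) c d
      rw [hAs]
      rwa [b] at this
  have hpig : ∃ i ∈ Finset.range (2 * m + 1), ∃ k ∈ Finset.range (2 * m + 1), i ≠ k ∧
      ∑ j ∈ A i, u j = ∑ j ∈ A k, u j := by
    apply Finset.exists_ne_map_eq_of_card_lt_of_maps_to (t := Finset.Ioc (-(m : ℤ)) m)
    · simp; omega
    · intro n hn
      have hn' : n < 2 * m + 1 := by simpa using hn
      have := hinv n (by omega)
      simpa using this.2.2
  have fin : ∀ i k, i < k → k ≤ 2 * m → ∑ j ∈ A i, u j = ∑ j ∈ A k, u j → False := by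
    intro i k hik hk he
    have hsub := hmono hik.le
    obtain ⟨a, b, -, -⟩ := hinv k hk
    obtain ⟨a', b', -, -⟩ := hinv i (by omega)
    have h1 := Finset.sum_sdiff (f := u) hsub
    have hPS : A k \ A i ⊆ S := Finset.sdiff_subset.trans a
    have h2 := Finset.sum_sdiff (f := u) hPS
    have h3 := Finset.card_sdiff_of_subset hsub
    refine hno' _ hPS ?_ (by omega) (by linarith) (by linarith)
    rw [← Finset.card_pos]; omega
  obtain ⟨i, hi, k, hk, hne, he⟩ := hpig
  simp only [Finset.mem_range] at hi hk
  rcases lt_or_gt_of_ne hne with h | h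
  · exact fin i k h (by omega) he
  · exact fin k i h (by omega) he.symm

theorem bc_main (m : ℕ) (hm : 1 ≤ m) (u : ℕ → ℤ) (S : Finset ℕ)
    (hbd : ∀ j ∈ S, |u j| ≤ (m : ℤ)) (hsum : 0 ≤ ∑ j ∈ S, u j) :
    ∃ Part : Finset (Finset ℕ),
      (∀ P ∈ Part, P.Nonempty) ∧
      (∀ P ∈ Part, ∀ Q ∈ Part, P ≠ Q → Disjoint P Q) ∧
      Part.biUnion id = S ∧
      (∀ P ∈ Part, P.card ≤ 2 * m + 1 ∧ 0 ≤ ∑ j ∈ P, u j) := by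
  induction S using Finset.strongInduction with
  | H S ih =>
    rcases S.eq_empty_or_nonempty with rfl | hne
    · exact ⟨∅, by simp⟩
    obtain ⟨P, hPS, hP, hc, h1, h2⟩ := bc_step m hm u S hne hbd hsum
    obtain ⟨T, t1, t2, t3, t4⟩ := ih (S \ P) (Finset.sdiff_ssubset hPS hP)
      (fun j hj => hbd j (Finset.mem_sdiff.1 hj).1) h2
    have hd : ∀ Q ∈ T, Disjoint P Q := by
      intro Q hQ
      have hQ' : Q ⊆ S \ P := by
        rw [← t3]; exact Finset.subset_biUnion_of_mem id hQ
      exact Finset.disjoint_of_subset_right hQ' Finset.disjoint_sdiff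
    refine ⟨insert P T, ?_, ?_, ?_, ?_⟩
    · intro Q hQ
      rcases Finset.mem_insert.1 hQ with rfl | hQ
      · exact hP
      · exact t1 Q hQ
    · intro Q hQ R hR hne
      rcases Finset.mem_insert.1 hQ with rfl | hQ2 <;> rcases Finset.mem_insert.1 hR with rfl | hR2
      · exact (hne rfl).elim
      · exact hd R hR2
      · exact (hd Q hQ2).symm
      · exact t2 Q hQ2 R hR2 hne
    · rw [Finset.biUnion_insert, t3]
      exact Finset.union_sdiff_of_subset hPS
    · intro Q hQ
      rcases Finset.mem_insert.1 hQ with rfl | hQ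
      · exact ⟨hc, h1⟩
      · exact t4 Q hQ

/-- The Balanced Clustering Lemma (Lemma 7/9 of the paper), abstract form: if
`|u(j)| ≤ m` for all `j ∈ {1,…,I}` and `Σ_{j=1}^I u(j) ≥ I + m`, then `{1,…,I}` can be
partitioned into nonempty parts of size at most `2m + 1`, each of nonnegative total
weight. -/
theorem stmt_8 (I m : ℕ) (hI : 1 ≤ I) (hm : 1 ≤ m) (u : ℕ → ℤ)
    (hbd : ∀ j, 1 ≤ j → j ≤ I → |u j| ≤ (m : ℤ))
    (hsum : (I : ℤ) + (m : ℤ) ≤ ∑ j ∈ Finset.Icc 1 I, u j) :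
    ∃ Part : Finset (Finset ℕ),
      (∀ P ∈ Part, P.Nonempty) ∧
      (∀ P ∈ Part, ∀ Q ∈ Part, P ≠ Q → Disjoint P Q) ∧
      Part.biUnion id = Finset.Icc 1 I ∧
      (∀ P ∈ Part, P.card ≤ 2 * m + 1 ∧ 0 ≤ ∑ j ∈ P, u j) := by
  exact bc_main m hm u _ (fun j hj => hbd j (Finset.mem_Icc.1 hj).1 (Finset.mem_Icc.1 hj).2)
    (le_trans (by positivity) hsum)
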